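/- (Main Theorem, metric variation.) Suppose ∂₁²f + ∂₂²f is a constant function on ℝ⁴. Let Γ be the full connection of the generalised pp-wave with purely axial torsion and R = R[Γ] its curvature. For a symmetric smooth compactly supported h_{μν} : ℝ⁴ → ℝ, let g(t) = g + t h; for |t| small enough g(t) is pointwise invertible with inverse g(t)^{μν}, and define q(t) = R^κ_{λμν} R^λ_{καβ} g(t)^{μα} g(t)^{νβ} √|det g(t)|. Then the function t ↦ ∫_{ℝ⁴} ( q(t) − q(0) ) dx (Lebesgue integral; the integrand is compactly supported) is differentiable at t = 0 with derivative 0; i.e., the Yang–Mills action is stationary at the pp-metric under compactly supported metric variations. -/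

import Mathlib

noncomputable section

open scoped BigOperators

/-- Points of spacetime: ℝ⁴ with coordinates x⁰, x¹, x², x³. -/
abbrev Spacetime := Fin 4 → ℝ

/-- Partial derivative ∂_μ of a scalar function. -/
def pd (μ : Fin 4) (h : Spacetime → ℝ) : Spacetime → ℝ :=
  fun x => fderiv ℝ h x (Pi.single μ 1)

/-- The pp-metric g_{μν}: nonzero components g₀₃ = g₃₀ = 1, g₁₁ = g₂₂ = −1, g₃₃ = f. -/
def ppMetric (f : Spacetime → ℝ) (x : Spacetime) (μ ν : Fin 4) : ℝ :=
  if μ = 0 ∧ ν = 3 then 1 else if μ = 3 ∧ ν = 0 then 1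
  else if μ = 1 ∧ ν = 1 then -1 else if μ = 2 ∧ ν = 2 then -1
  else if μ = 3 ∧ ν = 3 then f x else 0

/-- The pointwise inverse metric g^{μν}: g⁰⁰ = −f, g⁰³ = g³⁰ = 1, g¹¹ = g²² = −1. -/
def ppMetricInv (f : Spacetime → ℝ) (x : Spacetime) (μ ν : Fin 4) : ℝ :=
  if μ = 0 ∧ ν = 0 then -(f x) else if μ = 0 ∧ ν = 3 then 1
  else if μ = 3 ∧ ν = 0 then 1
  else if μ = 1 ∧ ν = 1 then -1 else if μ = 2 ∧ ν = 2 then -1 else 0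

/-- Christoffel symbols {Γ}^λ_{μν} = ½ g^{λκ}(∂_μ g_{κν} + ∂_ν g_{κμ} − ∂_κ g_{μν}). -/
def christoffel (f : Spacetime → ℝ) (x : Spacetime) (l μ ν : Fin 4) : ℝ :=
  (1/2) * ∑ κ, ppMetricInv f x l κ *
    (pd μ (fun y => ppMetric f y κ ν) x + pd ν (fun y => ppMetric f y κ μ) x
      - pd κ (fun y => ppMetric f y μ ν) x)

/-- Totally antisymmetric symbol ε with ε₀₁₂₃ = 1. -/
def eps (a b c d : Fin 4) : ℝ :=
  ((((b:ℕ):ℝ) - ((a:ℕ):ℝ)) * (((c:ℕ):ℝ) - ((a:ℕ):ℝ)) * (((d:ℕ):ℝ) - ((a:ℕ):ℝ)) *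
    (((c:ℕ):ℝ) - ((b:ℕ):ℝ)) * (((d:ℕ):ℝ) - ((b:ℕ):ℝ)) * (((d:ℕ):ℝ) - ((c:ℕ):ℝ))) / 12

/-- Purely axial torsion T_{κμν} = k(x³) ε_{0κμν}. -/
def torsion (k : ℝ → ℝ) (x : Spacetime) (κ μ ν : Fin 4) : ℝ :=
  k (x 3) * eps 0 κ μ ν

/-- Contorsion K^κ_{μν} = ½ g^{κρ} T_{ρμν}. -/
def contorsion (f : Spacetime → ℝ) (k : ℝ → ℝ) (x : Spacetime) (κ μ ν : Fin 4) : ℝ :=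
  (1/2) * ∑ ρ, ppMetricInv f x κ ρ * torsion k x ρ μ ν

/-- The full connection Γ^λ_{μν} = {Γ}^λ_{μν} + K^λ_{μν}. -/
def fullConn (f : Spacetime → ℝ) (k : ℝ → ℝ) (x : Spacetime) (κ μ ν : Fin 4) : ℝ :=
  christoffel f x κ μ ν + contorsion f k x κ μ ν

/-- Curvature R[A]^κ_{λμν} of connection coefficients A^κ_{μν}. -/
def curv (A : Spacetime → Fin 4 → Fin 4 → Fin 4 → ℝ) (x : Spacetime)
    (κ l μ ν : Fin 4) : ℝ :=
  pd μ (fun y => A y κ ν l) x - pd ν (fun y => A y κ μ l) x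
    + ∑ η, (A x κ μ η * A x η ν l - A x κ ν η * A x η μ l)

/-- The parallel null vector field l^μ = (1,0,0,0). -/
def lUp : Fin 4 → ℝ := fun μ => if μ = 0 then 1 else 0

/-- The lowered vector l_μ = g_{μν} l^ν = (0,0,0,1). -/
def lCov : Fin 4 → ℝ := fun μ => if μ = 3 then 1 else 0

open MeasureTheory

/-- The varied metric g(t) = g + t h, as a matrix. -/
def variedMetric (f : Spacetime → ℝ) (h : Spacetime → Fin 4 → Fin 4 → ℝ)
    (t : ℝ) (x : Spacetime) : Matrix (Fin 4) (Fin 4) ℝ :=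
  Matrix.of fun μ ν => ppMetric f x μ ν + t * h x μ ν

/-- The Yang–Mills Lagrangian density q(t) = R^κ_{λμν} R^λ_{καβ} g(t)^{μα} g(t)^{νβ} √|det g(t)|,
where R is the curvature of the full connection (for small t the matrix inverse is the
pointwise inverse of g(t)). -/
def qMet (f : Spacetime → ℝ) (k : ℝ → ℝ) (h : Spacetime → Fin 4 → Fin 4 → ℝ)
    (t : ℝ) (x : Spacetime) : ℝ :=
  ∑ κ, ∑ lam, ∑ μ, ∑ ν, ∑ α, ∑ β,
    curv (fullConn f k) x κ lam μ ν * curv (fullConn f k) x lam κ α β *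
      (variedMetric f h t x)⁻¹ μ α * (variedMetric f h t x)⁻¹ ν β *
        Real.sqrt |(variedMetric f h t x).det|

lemma pd_const (μ : Fin 4) (c : ℝ) (x : Spacetime) : pd μ (fun _ => c) x = 0 := by
  simp [pd]

/-- Only the component `g₃₃` of the pp-metric has nonzero derivatives. -/
lemma pd_ppMetric (f : Spacetime → ℝ) (ρ μ ν : Fin 4) (x : Spacetime) :
    pd ρ (fun y => ppMetric f y μ ν) x = if μ = 3 ∧ ν = 3 then pd ρ f x else 0 := by
  by_cases hμν : μ = 3 ∧ ν = 3
  · obtain ⟨rfl, rfl⟩ := hμν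
    simp [ppMetric]
  · simp only [ppMetric, hμν, if_false, pd_const]

lemma pd_comp_coord_of_ne {k : ℝ → ℝ} (hk : Differentiable ℝ k) {μ ν : Fin 4} (hμν : μ ≠ ν)
    (x : Spacetime) : pd μ (fun y => k (y ν)) x = 0 := by
  have hcoord : HasFDerivAt (fun y : Spacetime => y ν)
      (ContinuousLinearMap.proj (R := ℝ) (φ := fun _ : Fin 4 => ℝ) ν) x :=
    (ContinuousLinearMap.proj (R := ℝ) (φ := fun _ : Fin 4 => ℝ) ν).hasFDerivAt
  have hcomp := (hk (x ν)).hasDerivAt.comp_hasFDerivAt x hcoord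
  have heq : fderiv ℝ (fun y : Spacetime => k (y ν)) x = _ := hcomp.fderiv
  simp [pd, heq, Pi.single_eq_of_ne hμν.symm]

/-- The position of a coordinate direction in the flag `⟨∂₀⟩ ⊂ ⟨∂₀, ∂₁, ∂₂⟩ ⊂ ⟨∂₀, ∂₁, ∂₂, ∂₃⟩`,
which the full connection preserves. -/
def flagLevel : Fin 4 → ℕ := ![0, 1, 1, 2]

/-- The generator of rotations in the `x¹x²`-plane. -/
def rotationGenerator (κ l : Fin 4) : ℝ :=
  if κ = 1 ∧ l = 2 then 1 else if κ = 2 ∧ l = 1 then -1 else 0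

lemma rotationGenerator_of_flagLevel_lt {κ l : Fin 4} (hl : flagLevel l < flagLevel κ) :
    rotationGenerator κ l = 0 := by
  have h₁ : ¬(κ = 1 ∧ l = 2) := by rintro ⟨rfl, rfl⟩; simp [flagLevel] at hl
  have h₂ : ¬(κ = 2 ∧ l = 1) := by rintro ⟨rfl, rfl⟩; simp [flagLevel] at hl
  simp [rotationGenerator, h₁, h₂]

/-- Modulo the strictly flag-raising part, the full connection is `½ k(x³) dx³` times the
rotation generator. -/
lemma fullConn_of_flagLevel_le {f : Spacetime → ℝ} (h0 : ∀ x, pd 0 f x = 0) (k : ℝ → ℝ)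
    {κ l : Fin 4} (hl : flagLevel l ≤ flagLevel κ) (μ : Fin 4) (x : Spacetime) :
    fullConn f k x κ μ l = (if μ = 3 then rotationGenerator κ l / 2 else 0) * k (x 3) := by
  simp only [fullConn, christoffel, contorsion, torsion, pd_ppMetric, Fin.sum_univ_four]
  fin_cases κ <;> fin_cases l <;> first
    | (exfalso; revert hl; decide)
    | (fin_cases μ <;> simp [ppMetricInv, eps, rotationGenerator, h0] <;> ring)

/-- The curvature strictly raises the flag. -/
lemma curv_fullConn_of_flagLevel_le {f : Spacetime → ℝ} (h0 : ∀ x, pd 0 f x = 0) {k : ℝ → ℝ}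
    (hk : Differentiable ℝ k) {κ l : Fin 4} (hl : flagLevel l ≤ flagLevel κ) (μ ν : Fin 4)
    (x : Spacetime) : curv (fullConn f k) x κ l μ ν = 0 := by
  have hpd (c : ℝ) {ρ : Fin 4} (hρ : ρ ≠ 3) : pd ρ (fun y => c * k (y 3)) x = 0 :=
    pd_comp_coord_of_ne (hk.const_mul c) hρ x
  have hcurl : pd μ (fun y => fullConn f k y κ ν l) x - pd ν (fun y => fullConn f k y κ μ l) x
      = 0 := by
    simp only [fullConn_of_flagLevel_le h0 k hl]
    by_cases hμ : μ = 3 <;> by_cases hν : ν = 3 <;> simp [hμ, hν, hpd, pd_const]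
  have hcomm (η : Fin 4) : fullConn f k x κ μ η * fullConn f k x η ν l
      - fullConn f k x κ ν η * fullConn f k x η μ l = 0 := by
    rcases lt_or_ge (flagLevel κ) (flagLevel η) with hη | hη
    · simp [fullConn_of_flagLevel_le h0 k (hl.trans hη.le), rotationGenerator_of_flagLevel_lt
        (hl.trans_lt hη)]
    rcases lt_or_ge (flagLevel η) (flagLevel l) with hη' | hη'
    · simp [fullConn_of_flagLevel_le h0 k hη, rotationGenerator_of_flagLevel_lt
        (hη'.trans_le hl)]
    simp only [fullConn_of_flagLevel_le h0 k hη, fullConn_of_flagLevel_le h0 k hη']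
    split_ifs <;> ring
  simp only [curv, hcurl, hcomm, Finset.sum_const_zero, add_zero]

/-- The traces `R^κ_{λμν} R^λ_{καβ}` vanish, and with them the Yang–Mills density of any metric. -/
lemma qMet_eq_zero {f : Spacetime → ℝ} (h0 : ∀ x, pd 0 f x = 0) {k : ℝ → ℝ}
    (hk : Differentiable ℝ k) (h : Spacetime → Fin 4 → Fin 4 → ℝ) (t : ℝ) (x : Spacetime) :
    qMet f k h t x = 0 := by
  have hprod (κ l μ ν α β : Fin 4) :
      curv (fullConn f k) x κ l μ ν * curv (fullConn f k) x l κ α β = 0 := by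
    rcases le_total (flagLevel l) (flagLevel κ) with hl | hl
    · rw [curv_fullConn_of_flagLevel_le h0 hk hl, zero_mul]
    · rw [curv_fullConn_of_flagLevel_le h0 hk hl, mul_zero]
  simp only [qMet, hprod, zero_mul, Finset.sum_const_zero]

/-- Main Theorem, metric variation: if ∂₁²f + ∂₂²f is constant, then
the Yang–Mills action is stationary at the pp-metric under compactly supported
symmetric variations of the metric. -/
theorem main_theorem_metric_variation
    (f : Spacetime → ℝ) (hf : ContDiff ℝ (⊤ : ℕ∞) f) (h0 : ∀ x, pd 0 f x = 0)
    (k : ℝ → ℝ) (hk : ContDiff ℝ (⊤ : ℕ∞) k)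
    (hlap : ∃ c : ℝ, ∀ x : Spacetime, pd 1 (pd 1 f) x + pd 2 (pd 2 f) x = c)
    (h : Spacetime → Fin 4 → Fin 4 → ℝ)
    (hsym : ∀ (x : Spacetime) (μ ν : Fin 4), h x μ ν = h x ν μ)
    (hsm : ∀ μ ν, ContDiff ℝ (⊤ : ℕ∞) (fun x => h x μ ν))
    (hc : HasCompactSupport h) :
    HasDerivAt (fun t : ℝ =>
      ∫ x : Spacetime, (qMet f k h t x - qMet f k h 0 x)) 0 0 := by
  have hq := qMet_eq_zero h0 (hk.differentiable (by simp)) h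
  simpa only [hq, sub_self, integral_zero] using hasDerivAt_const (0 : ℝ) (0 : ℝ)
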